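/- arXiv:2008.06596 — 2 statements merged into one kernel-verified Lean document; each statement's English description precedes it below -/
import Mathlib

section
/- Define g₂ : [0,1) → ℝ by g₂(C) = C² + 2(1 − C/3)²{C + log(1−C)}. Then g₂'(0) = 0, g₂''(0) = 0, and for every C ∈ (0,1) the third derivative satisfies g₂'''(C) = −4C(3C² − 8C + 9)/{9(1−C)³} < 0. Consequently g₂'(C) < 0 for all C ∈ (0,1), and g₂ is strictly decreasing on (0,1). -/
open Set

/-- `g₂(C) = C² + 2(1 - C/3)²{C + log(1-C)}`. -/
noncomputable def g2 (C : ℝ) : ℝ :=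
  C ^ 2 + 2 * (1 - C / 3) ^ 2 * (C + Real.log (1 - C))

/-- The first derivative of `g2` on `(-∞, 1)`. -/
noncomputable def g2Deriv (C : ℝ) : ℝ :=
  2 * C - 4 / 3 * (1 - C / 3) * (C + Real.log (1 - C)) + 2 * (1 - C / 3) ^ 2 * (1 - 1 / (1 - C))

/-- The second derivative of `g2` on `(-∞, 1)`. -/
noncomputable def g2Deriv2 (C : ℝ) : ℝ :=
  2 + 4 / 9 * (C + Real.log (1 - C)) - 8 / 3 * (1 - C / 3) * (1 - 1 / (1 - C))
    - 2 * (1 - C / 3) ^ 2 * (1 / (1 - C) ^ 2)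

lemma hasDerivAt_add_log_one_sub {C : ℝ} (hC : C < 1) :
    HasDerivAt (fun x : ℝ => x + Real.log (1 - x)) (1 - 1 / (1 - C)) C := by
  have h := (hasDerivAt_id' C).fun_add (((hasDerivAt_id' C).const_sub 1).log (by linarith))
  refine h.congr_deriv ?_
  ring

lemma hasDerivAt_one_sub_div_three (C : ℝ) :
    HasDerivAt (fun x : ℝ => 1 - x / 3) (-(1 / 3)) C :=
  ((hasDerivAt_id' C).div_const 3).const_sub 1

lemma hasDerivAt_one_sub_one_div_one_sub {C : ℝ} (hC : C < 1) :
    HasDerivAt (fun x : ℝ => 1 - 1 / (1 - x)) (-(1 / (1 - C) ^ 2)) C := by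
  have h := (((hasDerivAt_id' C).const_sub 1).fun_inv (by linarith)).const_sub 1
  simp only [one_div]
  refine h.congr_deriv ?_
  ring

lemma hasDerivAt_g2 {C : ℝ} (hC : C < 1) : HasDerivAt g2 (g2Deriv C) C := by
  have h := ((hasDerivAt_id' C).fun_pow 2).fun_add
    ((((hasDerivAt_one_sub_div_three C).fun_pow 2).const_mul 2).fun_mul
      (hasDerivAt_add_log_one_sub hC))
  refine h.congr_deriv ?_
  simp only [g2Deriv]
  push_cast
  ring

lemma hasDerivAt_g2Deriv {C : ℝ} (hC : C < 1) : HasDerivAt g2Deriv (g2Deriv2 C) C := by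
  have h := (((hasDerivAt_id' C).const_mul 2).fun_sub
    (((hasDerivAt_one_sub_div_three C).const_mul (4 / 3)).fun_mul
      (hasDerivAt_add_log_one_sub hC))).fun_add
    ((((hasDerivAt_one_sub_div_three C).fun_pow 2).const_mul 2).fun_mul
      (hasDerivAt_one_sub_one_div_one_sub hC))
  refine h.congr_deriv ?_
  simp only [g2Deriv2]
  push_cast
  ring

lemma hasDerivAt_g2Deriv2 {C : ℝ} (hC : C < 1) :
    HasDerivAt g2Deriv2 (-4 * C * (3 * C ^ 2 - 8 * C + 9) / (9 * (1 - C) ^ 3)) C := by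
  have hne : 1 - C ≠ 0 := by linarith
  have hsq : HasDerivAt (fun x : ℝ => 1 / (1 - x) ^ 2) (2 / (1 - C) ^ 3) C := by
    have h := (((hasDerivAt_id' C).const_sub 1).fun_pow 2).fun_inv (pow_ne_zero 2 hne)
    simp only [one_div]
    refine h.congr_deriv ?_
    push_cast
    field_simp
  have h := ((((hasDerivAt_add_log_one_sub hC).const_mul (4 / 9)).const_add 2).fun_sub
    (((hasDerivAt_one_sub_div_three C).const_mul (8 / 3)).fun_mul
      (hasDerivAt_one_sub_one_div_one_sub hC))).fun_sub
    ((((hasDerivAt_one_sub_div_three C).fun_pow 2).const_mul 2).fun_mul hsq)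
  refine h.congr_deriv ?_
  push_cast
  field_simp
  ring

lemma deriv_g2_eventuallyEq {C : ℝ} (hC : C < 1) : deriv g2 =ᶠ[nhds C] g2Deriv := by
  filter_upwards [Iio_mem_nhds hC] with x hx using (hasDerivAt_g2 hx).deriv

lemma deriv_deriv_g2_eventuallyEq {C : ℝ} (hC : C < 1) :
    deriv (deriv g2) =ᶠ[nhds C] g2Deriv2 := by
  filter_upwards [Iio_mem_nhds hC] with x hx
  rw [(deriv_g2_eventuallyEq hx).deriv_eq, (hasDerivAt_g2Deriv hx).deriv]

lemma third_deriv_formula_neg {C : ℝ} (hC : C ∈ Ioo (0 : ℝ) 1) :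
    -4 * C * (3 * C ^ 2 - 8 * C + 9) / (9 * (1 - C) ^ 3) < 0 := by
  have h1 : 0 < 1 - C := sub_pos.2 hC.2
  have h2 : 0 < 3 * C ^ 2 - 8 * C + 9 := by nlinarith [sq_nonneg (3 * C - 4)]
  refine div_neg_of_neg_of_pos ?_ (by positivity)
  nlinarith [mul_pos hC.1 h2]

/-- A function vanishing at `0` with negative derivative on `(0, 1)` is negative there. -/
lemma neg_of_hasDerivAt_neg {f f' : ℝ → ℝ} (hf : ∀ x < 1, HasDerivAt f (f' x) x)
    (hf0 : f 0 = 0) (hf' : ∀ x ∈ Ioo (0 : ℝ) 1, f' x < 0) {C : ℝ} (hC : C ∈ Ioo (0 : ℝ) 1) :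
    f C < 0 := by
  have hanti : StrictAntiOn f (Ico 0 1) := by
    refine strictAntiOn_of_deriv_neg (convex_Ico 0 1)
      (fun x hx => (hf x hx.2).continuousAt.continuousWithinAt) fun x hx => ?_
    rw [interior_Ico] at hx
    rw [(hf x hx.2).deriv]
    exact hf' x hx
  simpa [hf0] using hanti (left_mem_Ico.2 one_pos) (Ioo_subset_Ico_self hC) hC.1

lemma g2Deriv_zero : g2Deriv 0 = 0 := by
  norm_num [g2Deriv]

lemma g2Deriv2_zero : g2Deriv2 0 = 0 := by
  norm_num [g2Deriv2]

lemma g2Deriv_neg {C : ℝ} (hC : C ∈ Ioo (0 : ℝ) 1) : g2Deriv C < 0 :=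
  neg_of_hasDerivAt_neg (fun _ hx => hasDerivAt_g2Deriv hx) g2Deriv_zero
    (fun _ hx => neg_of_hasDerivAt_neg (fun _ hy => hasDerivAt_g2Deriv2 hy) g2Deriv2_zero
      (fun _ hy => third_deriv_formula_neg hy) hx) hC

/-- For `g₂(C) = C² + 2(1 - C/3)²{C + log(1-C)}`:
`g₂'(0) = 0`, `g₂''(0) = 0`, for every `C ∈ (0,1)` the third derivative equals
`-4C(3C² - 8C + 9)/{9(1-C)³}` and is strictly negative; consequently `g₂'(C) < 0`
on `(0,1)` and `g₂` is strictly decreasing on `(0,1)`. -/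
theorem g2_third_deriv_neg_strictAnti :
    deriv g2 0 = 0 ∧
    deriv (deriv g2) 0 = 0 ∧
    (∀ C : ℝ, C ∈ Ioo (0 : ℝ) 1 →
      deriv (deriv (deriv g2)) C = -4 * C * (3 * C ^ 2 - 8 * C + 9) / (9 * (1 - C) ^ 3) ∧
      -4 * C * (3 * C ^ 2 - 8 * C + 9) / (9 * (1 - C) ^ 3) < 0) ∧
    (∀ C : ℝ, C ∈ Ioo (0 : ℝ) 1 → deriv g2 C < 0) ∧
    StrictAntiOn g2 (Ioo (0 : ℝ) 1) := by
  have hneg : ∀ C : ℝ, C ∈ Ioo (0 : ℝ) 1 → deriv g2 C < 0 := fun C hC => by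
    rw [(hasDerivAt_g2 hC.2).deriv]
    exact g2Deriv_neg hC
  refine ⟨?_, ?_, fun C hC => ⟨?_, third_deriv_formula_neg hC⟩, hneg, ?_⟩
  · rw [(hasDerivAt_g2 one_pos).deriv, g2Deriv_zero]
  · rw [(deriv_deriv_g2_eventuallyEq one_pos).eq_of_nhds, g2Deriv2_zero]
  · rw [(deriv_deriv_g2_eventuallyEq hC.2).deriv_eq, (hasDerivAt_g2Deriv2 hC.2).deriv]
  · refine strictAntiOn_of_deriv_neg (convex_Ioo 0 1)
      (fun x hx => (hasDerivAt_g2 hx.2).continuousAt.continuousWithinAt) fun x hx => ?_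
    rw [interior_Ioo] at hx
    exact hneg x hx
end

section
/- For every real number C with 0 < C < 1, one has C² + 2(1 − C/3)²{C + log(1−C)} < 0; equivalently, C² < −2(1 − C/3)²{C + log(1−C)}. -/
theorem hasDerivAt_add_log_one_sub_add_sq_div {x : ℝ} (hx : x < 1) :
    HasDerivAt (fun y : ℝ => y + Real.log (1 - y) + 9 * y ^ 2 / (2 * (3 - y) ^ 2))
      (x * (27 / (3 - x) ^ 3 - 1 / (1 - x))) x := by
  have h1 : 1 - x ≠ 0 := by linarith
  have h3 : 3 - x ≠ 0 := by linarith
  have hlog := ((hasDerivAt_id' x).const_sub 1).log h1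
  have hnum := ((hasDerivAt_id' x).pow 2).const_mul 9
  have hden := (((hasDerivAt_id' x).const_sub 3).pow 2).const_mul 2
  have hden0 : 2 * (3 - x) ^ 2 ≠ 0 := by positivity
  refine (((hasDerivAt_id' x).add hlog).add (hnum.div hden hden0)).congr_deriv ?_
  simp only [Pi.pow_apply]
  field_simp
  ring

theorem strictAntiOn_add_log_one_sub_add_sq_div :
    StrictAntiOn (fun y : ℝ => y + Real.log (1 - y) + 9 * y ^ 2 / (2 * (3 - y) ^ 2))
      (Set.Ico 0 1) := by
  refine strictAntiOn_of_deriv_neg (convex_Ico 0 1)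
    (fun x hx => (hasDerivAt_add_log_one_sub_add_sq_div hx.2).continuousAt.continuousWithinAt) ?_
  intro x hx
  rw [interior_Ico] at hx
  obtain ⟨h0, h1⟩ := hx
  rw [(hasDerivAt_add_log_one_sub_add_sq_div h1).deriv]
  refine mul_neg_of_pos_of_neg h0 (sub_neg.2 ?_)
  rw [div_lt_div_iff₀ (pow_pos (by linarith) 3) (by linarith)]
  nlinarith [mul_pos (pow_pos h0 2) (show 0 < 9 - x by linarith)]

/-- For every real `C` with `0 < C < 1`,
`C² + 2(1 - C/3)²{C + log(1-C)} < 0`, i.e. `C² < -2(1 - C/3)²{C + log(1-C)}`. -/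
theorem sq_lt_neg_two_mul_bartlett_add_log (C : ℝ) (h0 : 0 < C) (h1 : C < 1) :
    C ^ 2 + 2 * (1 - C / 3) ^ 2 * (C + Real.log (1 - C)) < 0 := by
  have h := strictAntiOn_add_log_one_sub_add_sq_div ⟨le_rfl, one_pos⟩ ⟨h0.le, h1⟩ h0
  norm_num at h
  have h3 : 3 - C ≠ 0 := by linarith
  calc C ^ 2 + 2 * (1 - C / 3) ^ 2 * (C + Real.log (1 - C))
      = 2 * (1 - C / 3) ^ 2 * (C + Real.log (1 - C) + 9 * C ^ 2 / (2 * (3 - C) ^ 2)) := by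
        field_simp
        ring
    _ < 0 := mul_neg_of_pos_of_neg (mul_pos two_pos (pow_pos (by linarith) 2)) h
end
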